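/- (Infeasibility certificate for the divide-and-conquer algorithm.) Let 0 ≤ l < h ≤ n, κ ≥ 2, and ε ≥ 0. If for every index i with l < i < h at least one of the super buckets (l, i] and (i, h] is not ε-biased, then no ε-biased κ-binning of the range (l, h] exists. -/

import Mathlib

/-- Number of blue tuples among the first `i` tuples (tuples are indexed `1,…,n`,
`g j = true` means tuple `j` is blue). -/
def blueCount (g : ℕ → Bool) (i : ℕ) : ℕ :=
  ((Finset.Icc 1 i).filter (fun j => g j = true)).card

/-- The bucket `(i, j]` is ε-biased: its blue ratio deviates from the overall
blue ratio `r_n = c(n)/n` by at most `ε`. -/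
def epsBiasedBucket (g : ℕ → Bool) (n : ℕ) (ε : ℚ) (i j : ℕ) : Prop :=
  |((blueCount g j : ℚ) - (blueCount g i : ℚ)) / ((j : ℚ) - (i : ℚ))
    - (blueCount g n : ℚ) / n| ≤ ε

/-- An ε-biased `κ`-binning of the range `(l, h]`: boundaries
`l = b 0 < b 1 < ⋯ < b κ = h` such that every bucket `(b j, b (j+1)]`
is ε-biased. -/
def epsBiasedBinning (g : ℕ → Bool) (n : ℕ) (ε : ℚ) (l h κ : ℕ) : Prop :=
  ∃ b : ℕ → ℕ, b 0 = l ∧ b κ = h ∧ (∀ j < κ, b j < b (j + 1)) ∧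
    ∀ j < κ, epsBiasedBucket g n ε (b j) (b (j + 1))

/-- Two adjacent ε-biased buckets merge into an ε-biased bucket. -/
theorem epsBiasedBucket_merge {g : ℕ → Bool} {n : ℕ} {ε : ℚ} {i j k : ℕ}
    (hij : i < j) (hjk : j < k) (h₁ : epsBiasedBucket g n ε i j)
    (h₂ : epsBiasedBucket g n ε j k) : epsBiasedBucket g n ε i k := by
  unfold epsBiasedBucket at *
  have hp : (0 : ℚ) < (j : ℚ) - i := sub_pos.2 (by exact_mod_cast hij)
  have hq : (0 : ℚ) < (k : ℚ) - j := sub_pos.2 (by exact_mod_cast hjk)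
  have hpq : (0 : ℚ) < (k : ℚ) - i := by linarith
  generalize (blueCount g n : ℚ) / n = r at *
  rw [abs_le, le_sub_iff_add_le, sub_le_iff_le_add, le_div_iff₀ (by assumption),
    div_le_iff₀ (by assumption)] at *
  constructor <;> linarith

/-- Along a sequence of ε-biased buckets, every nonempty union of consecutive buckets is
nonempty and ε-biased. -/
theorem epsBiasedBucket_of_consecutive {g : ℕ → Bool} {n : ℕ} {ε : ℚ} {κ : ℕ} {b : ℕ → ℕ}
    (hlt : ∀ j < κ, b j < b (j + 1))
    (hb : ∀ j < κ, epsBiasedBucket g n ε (b j) (b (j + 1))) {s t : ℕ} (hst : s + 1 ≤ t)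
    (ht : t ≤ κ) : b s < b t ∧ epsBiasedBucket g n ε (b s) (b t) := by
  induction t, hst using Nat.le_induction with
  | base => exact ⟨hlt s ht, hb s ht⟩
  | succ t _ ih =>
    obtain ⟨h₁, h₂⟩ := ih (by omega)
    exact ⟨h₁.trans (hlt t ht), epsBiasedBucket_merge h₁ (hlt t ht) h₂ (hb t ht)⟩

/-- Infeasibility certificate for the divide-and-conquer algorithm: if for every
index `l < i < h` at least one of the super buckets `(l, i]` and `(i, h]` is not
ε-biased, then no ε-biased `κ`-binning of the range `(l, h]` exists (`κ ≥ 2`). -/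
theorem dnc_infeasibility_certificate
    (n l h κ : ℕ) (g : ℕ → Bool) (ε : ℚ)
    (hε : 0 ≤ ε) (hlh : l < h) (hhn : h ≤ n) (hκ : 2 ≤ κ)
    (hno : ∀ i, l < i → i < h →
      ¬ epsBiasedBucket g n ε l i ∨ ¬ epsBiasedBucket g n ε i h) :
    ¬ epsBiasedBinning g n ε l h κ := by
  rintro ⟨b, rfl, rfl, hlt, hb⟩
  obtain ⟨h₁, h₂⟩ := epsBiasedBucket_of_consecutive hlt hb (s := 1) hκ le_rfl
  exact (hno (b 1) (hlt 0 (by omega)) h₁).elim (· (hb 0 (by omega))) (· h₂)
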